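/- arXiv:2204.01461 — 9 statements merged into one kernel-verified Lean document; each statement's English description precedes it below -/
import Mathlib

section
/- Let (H, d) be a Hadamard space. For every x, y ∈ H and every ε > 0, the elementary set U_x(ε; y) = {z ∈ H : d(x, P_{[x,y]} z) < ε} is open in the metric topology of H. -/
open Filter Topology

/-- A geodesic structure on a metric space: a geodesic map `G` satisfying the
constant-speed property and the CAT(0) comparison inequality. Together with
completeness of the metric this makes the space a Hadamard space. -/
structure GeodesicStructure (H : Type*) [MetricSpace H] where
  G : H → H → ℝ → H
  G_zero : ∀ x y, G x y 0 = x
  G_one : ∀ x y, G x y 1 = y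
  G_dist : ∀ x y, ∀ s ∈ Set.Icc (0:ℝ) 1, ∀ t ∈ Set.Icc (0:ℝ) 1,
    dist (G x y s) (G x y t) = |s - t| * dist x y
  cat0 : ∀ x y z : H, ∀ t ∈ Set.Icc (0:ℝ) 1,
    dist (G x y t) z ^ 2 ≤
      (1 - t) * dist x z ^ 2 + t * dist y z ^ 2 - t * (1 - t) * dist x y ^ 2

variable {H : Type*} [MetricSpace H]

/-- The geodesic segment `[x,y]`. -/
def seg (D : GeodesicStructure H) (x y : H) : Set H :=
  (fun t => D.G x y t) '' Set.Icc (0:ℝ) 1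

/-- `P` is the metric-projection map: `P x y z` is the (unique) nearest point
to `z` on the geodesic segment `[x,y]`. -/
def IsProjMap (D : GeodesicStructure H) (P : H → H → H → H) : Prop :=
  ∀ x y z : H, P x y z ∈ seg D x y ∧ ∀ q ∈ seg D x y, dist z (P x y z) ≤ dist z q

/-- The set `U_x(ε; y_1, …, y_k)` for the finite family `Y` of endpoints. -/
def elemSet (P : H → H → H → H) (x : H) (ε : ℝ) (Y : Finset H) : Set H :=
  {z : H | ∀ y ∈ Y, dist x (P x y z) < ε}

/-- A set is weakly open if each of its points admits a basic set
`U_x(ε; y_1, …, y_k)` inside it. -/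
def WeaklyOpen (P : H → H → H → H) (U : Set H) : Prop :=
  ∀ x ∈ U, ∃ ε > (0:ℝ), ∃ Y : Finset H, Y.Nonempty ∧ elemSet P x ε Y ⊆ U

/-- Weak convergence: `d(l, P_{[l,y]} x_n) → 0` for every `y`. -/
def WeakConv (P : H → H → H → H) (x : ℕ → H) (l : H) : Prop :=
  ∀ y : H, Tendsto (fun n => dist l (P l y (x n))) atTop (nhds 0)

/-- The space is weakly proper if every point is interior (w.r.t. the weak
topology) to each of its elementary sets. -/
def WeaklyProper (P : H → H → H → H) : Prop :=
  ∀ (x : H) (ε : ℝ), 0 < ε → ∀ y : H,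
    ∃ V : Set H, WeaklyOpen P V ∧ x ∈ V ∧ V ⊆ elemSet P x ε {y}

/-- Geodesic convexity of a set. -/
def GConvex (D : GeodesicStructure H) (C : Set H) : Prop :=
  ∀ a ∈ C, ∀ b ∈ C, ∀ t ∈ Set.Icc (0:ℝ) 1, D.G a b t ∈ C

/-- The midpoint of two points of a geodesic segment, taken along `G`, again lies on that segment. -/
theorem GeodesicStructure.midpoint_mem_seg (D : GeodesicStructure H) {x y p q : H}
    (hp : p ∈ seg D x y) (hq : q ∈ seg D x y) : D.G p q (1 / 2) ∈ seg D x y := by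
  obtain ⟨s, hs, rfl⟩ := hp
  obtain ⟨t, ht, rfl⟩ := hq
  have hm : (s + t) / 2 ∈ Set.Icc (0 : ℝ) 1 :=
    ⟨by linarith [hs.1, ht.1], by linarith [hs.2, ht.2]⟩
  refine ⟨(s + t) / 2, hm, ?_⟩
  have h := D.cat0 (D.G x y s) (D.G x y t) (D.G x y ((s + t) / 2)) (1 / 2)
    ⟨by norm_num, by norm_num⟩
  rw [D.G_dist x y s hs _ hm, D.G_dist x y t ht _ hm, D.G_dist x y s hs t ht,
    mul_pow, mul_pow, mul_pow, sq_abs, sq_abs, sq_abs] at h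
  have h0 : dist (D.G (D.G x y s) (D.G x y t) (1 / 2)) (D.G x y ((s + t) / 2)) ^ 2 ≤ 0 := by
    refine h.trans (le_of_eq ?_)
    ring
  exact (dist_eq_zero.mp (pow_eq_zero_iff two_ne_zero |>.mp (le_antisymm h0 (sq_nonneg _)))).symm

/-- Quantitative uniqueness of the nearest point on a geodesic segment. -/
theorem IsProjMap.dist_sq_le {D : GeodesicStructure H} {P : H → H → H → H}
    (hP : IsProjMap D P) {x y z q : H} (hq : q ∈ seg D x y) :
    dist (P x y z) q ^ 2 ≤ 2 * (dist z q ^ 2 - dist z (P x y z) ^ 2) := by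
  have hm := (hP x y z).2 _ (D.midpoint_mem_seg (hP x y z).1 hq)
  have h := D.cat0 (P x y z) q z (1 / 2) ⟨by norm_num, by norm_num⟩
  rw [dist_comm _ z, dist_comm _ z, dist_comm q z] at h
  have := pow_le_pow_left₀ dist_nonneg hm 2
  linarith

/-- The metric projection onto a geodesic segment is continuous. -/
theorem IsProjMap.continuous {D : GeodesicStructure H} {P : H → H → H → H}
    (hP : IsProjMap D P) (x y : H) : Continuous (P x y) := by
  refine continuous_iff_continuousAt.mpr fun z => tendsto_iff_dist_tendsto_zero.mpr ?_
  have hbound : ∀ w, dist (P x y w) (P x y z) ≤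
      √(2 * ((2 * dist w z + dist z (P x y z)) ^ 2 - dist z (P x y z) ^ 2)) := fun w => by
    apply Real.le_sqrt_of_sq_le
    have h := hP.dist_sq_le (z := z) (hP x y w).1
    have hwz := (hP x y w).2 _ (hP x y z).1
    have h₁ := dist_triangle z w (P x y w)
    have h₂ := dist_triangle w z (P x y z)
    rw [dist_comm z w] at h₁
    have h₃ := pow_le_pow_left₀ dist_nonneg
      (show dist z (P x y w) ≤ 2 * dist w z + dist z (P x y z) by linarith) 2
    rw [dist_comm (P x y w)]
    linarith
  refine squeeze_zero (fun _ => dist_nonneg) hbound ?_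
  have hcont : Continuous fun w =>
      √(2 * ((2 * dist w z + dist z (P x y z)) ^ 2 - dist z (P x y z) ^ 2)) := by fun_prop
  simpa using hcont.tendsto z

/-- In a Hadamard space every elementary set
`U_x(ε; y) = {z | d(x, P_{[x,y]} z) < ε}` is open in the metric topology. -/
theorem stmt0 [CompleteSpace H] (D : GeodesicStructure H) (P : H → H → H → H)
    (hP : IsProjMap D P) (x y : H) (ε : ℝ) (hε : 0 < ε) :
    IsOpen {z : H | dist x (P x y z) < ε} := by
  exact isOpen_lt (continuous_const.dist (hP.continuous x y)) continuous_const
end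

section
/- Let (H, d) be a Hadamard space and C ⊆ H a convex set. Then C is closed in the metric topology if and only if C is weakly closed, i.e. the complement H \ C is weakly open. -/
open Filter Topology

variable {H : Type*} [MetricSpace H]

/-- A closed convex subset of a Hadamard space contains a nearest point to any given point. -/
lemma GConvex.exists_nearest_point [CompleteSpace H] {D : GeodesicStructure H} {C : Set H}
    (hC : GConvex D C) (hcl : IsClosed C) (hne : C.Nonempty) (x : H) :
    ∃ c ∈ C, ∀ w ∈ C, dist x c ≤ dist x w := by
  set δ := Metric.infDist x C with hδ
  have hδ0 : 0 ≤ δ := Metric.infDist_nonneg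
  have hle : ∀ w ∈ C, δ ≤ dist x w := fun w hw => Metric.infDist_le_dist_of_mem hw
  have hex : ∀ n : ℕ, ∃ u ∈ C, dist x u < δ + 1 / ((n : ℝ) + 1) := fun n =>
    (Metric.infDist_lt_iff hne).1 (lt_add_of_pos_right _ Nat.one_div_pos_of_nat)
  choose u huC hu using hex
  have hr : Tendsto (fun n : ℕ => δ + 1 / ((n : ℝ) + 1)) atTop (𝓝 δ) := by
    simpa using tendsto_const_nhds.add (tendsto_one_div_add_atTop_nhds_zero_nat (𝕜 := ℝ))
  have hcauchy : CauchySeq u := by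
    refine cauchySeq_of_le_tendsto_0
      (fun n : ℕ => √(4 * ((δ + 1 / ((n : ℝ) + 1)) ^ 2 - δ ^ 2))) (fun n m N hn hm => ?_) ?_
    · apply Real.le_sqrt_of_sq_le
      have hmid : δ ^ 2 ≤ dist (D.G (u n) (u m) (1 / 2)) x ^ 2 := by
        rw [dist_comm]
        exact pow_le_pow_left₀ hδ0 (hle _ (hC _ (huC n) _ (huC m) _ (by norm_num))) 2
      have hcat := D.cat0 (u n) (u m) x (1 / 2) (by norm_num)
      have hbound : ∀ k, N ≤ k → dist (u k) x ^ 2 ≤ (δ + 1 / ((N : ℝ) + 1)) ^ 2 := fun k hk => by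
        rw [dist_comm]
        refine pow_le_pow_left₀ dist_nonneg ((hu k).le.trans ?_) 2
        gcongr
      linarith [hbound n hn, hbound m hm]
    · have h := (((hr.pow 2).sub_const (δ ^ 2)).const_mul 4).sqrt
      simpa using h
  obtain ⟨c, hc⟩ := cauchySeq_tendsto_of_complete hcauchy
  refine ⟨c, hcl.mem_of_tendsto hc (Eventually.of_forall huC), fun w hw => ?_⟩
  exact (le_of_tendsto_of_tendsto' (tendsto_const_nhds.dist hc) hr fun n => (hu n).le).trans
    (hle w hw)

/-- If `c` is a nearest point to `q` in a convex set, then the angle at `c` towards any other point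
of the set is obtuse, in the sense of the Pythagorean inequality. -/
lemma GConvex.dist_sq_add_dist_sq_le {D : GeodesicStructure H} {C : Set H} (hC : GConvex D C)
    {q c z : H} (hc : c ∈ C) (hz : z ∈ C) (hmin : ∀ w ∈ C, dist q c ≤ dist q w) :
    dist c q ^ 2 + dist c z ^ 2 ≤ dist z q ^ 2 := by
  have hlim : Tendsto (fun t : ℝ => dist c q ^ 2 + (1 - t) * dist c z ^ 2) (𝓝[>] 0)
      (𝓝 (dist c q ^ 2 + dist c z ^ 2)) := by
    have hcont : Continuous fun t : ℝ => dist c q ^ 2 + (1 - t) * dist c z ^ 2 := by fun_prop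
    simpa using (hcont.tendsto 0).mono_left nhdsWithin_le_nhds
  refine le_of_tendsto hlim ?_
  filter_upwards [Ioc_mem_nhdsGT (zero_lt_one' ℝ)] with t ht
  have htI : t ∈ Set.Icc (0 : ℝ) 1 := ⟨ht.1.le, ht.2⟩
  have hnear : dist c q ^ 2 ≤ dist (D.G c z t) q ^ 2 := by
    rw [dist_comm c, dist_comm _ q]
    exact pow_le_pow_left₀ dist_nonneg (hmin _ (hC c hc z hz t htI)) 2
  refine le_of_mul_le_mul_left ?_ ht.1
  linarith [D.cat0 c z q t htI]

/-- Distances add up along a geodesic segment. -/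
lemma dist_add_dist_of_mem_seg {D : GeodesicStructure H} {x y q : H} (hq : q ∈ seg D x y) :
    dist x q + dist q y = dist x y := by
  obtain ⟨t, ht, rfl⟩ := hq
  have h0 := D.G_dist x y 0 (by simp) t ht
  have h1 := D.G_dist x y t ht 1 (by simp)
  rw [D.G_zero, zero_sub, abs_neg, abs_of_nonneg ht.1] at h0
  rw [D.G_one, abs_of_nonpos (by linarith [ht.2])] at h1
  simp only [h0, h1]
  ring

/-- If `c` is a nearest point to `x` in a convex set `C`, then every point of `C` projects to the
endpoint `c` of the segment `[x, c]`. -/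
lemma IsProjMap.eq_of_nearest_point {D : GeodesicStructure H} {P : H → H → H → H}
    (hP : IsProjMap D P) {C : Set H} (hC : GConvex D C) {x c z : H} (hc : c ∈ C) (hz : z ∈ C)
    (hmin : ∀ w ∈ C, dist x c ≤ dist x w) : P x c z = c := by
  obtain ⟨hmem, hproj⟩ := hP x c z
  have hadd := dist_add_dist_of_mem_seg hmem
  have hpyth := hC.dist_sq_add_dist_sq_le (q := P x c z) hc hz fun w hw => by
    linarith [hmin w hw, dist_triangle x (P x c z) w]
  have hle : dist z (P x c z) ^ 2 ≤ dist c z ^ 2 := by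
    rw [dist_comm c]
    exact pow_le_pow_left₀ dist_nonneg
      (hproj c ⟨1, by simp, D.G_one x c⟩) 2
  have hzero : dist c (P x c z) ^ 2 = 0 := le_antisymm (by linarith) (sq_nonneg _)
  exact (dist_eq_zero.1 (pow_eq_zero_iff two_ne_zero |>.1 hzero)).symm

/-- The basic sets of the weak topology contain metric balls around their centre. -/
lemma IsProjMap.ball_subset_elemSet {D : GeodesicStructure H} {P : H → H → H → H}
    (hP : IsProjMap D P) (x : H) (ε : ℝ) (Y : Finset H) :
    Metric.ball x (ε / 2) ⊆ elemSet P x ε Y := by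
  intro z hz y _
  have hproj := (hP x y z).2 x ⟨0, by simp, D.G_zero x y⟩
  rw [Metric.mem_ball] at hz
  linarith [dist_triangle x z (P x y z), dist_comm x z]

/-- Weakly open sets are open in the metric topology. -/
lemma WeaklyOpen.isOpen {D : GeodesicStructure H} {P : H → H → H → H} (hP : IsProjMap D P)
    {U : Set H} (hU : WeaklyOpen P U) : IsOpen U := by
  refine Metric.isOpen_iff.2 fun x hx => ?_
  obtain ⟨ε, hε, Y, -, hY⟩ := hU x hx
  exact ⟨ε / 2, half_pos hε, (hP.ball_subset_elemSet x ε Y).trans hY⟩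

/-- a convex subset of a Hadamard space is metrically closed iff
it is weakly closed (its complement is weakly open). -/
theorem stmt4 [CompleteSpace H] (D : GeodesicStructure H) (P : H → H → H → H)
    (hP : IsProjMap D P) (C : Set H) (hC : GConvex D C) :
    IsClosed C ↔ WeaklyOpen P Cᶜ := by
  refine ⟨fun hcl x hx => ?_, fun h => isOpen_compl_iff.1 (h.isOpen hP)⟩
  rcases C.eq_empty_or_nonempty with rfl | hne
  · exact ⟨1, one_pos, {x}, Finset.singleton_nonempty x, by simp⟩
  obtain ⟨c, hc, hmin⟩ := hC.exists_nearest_point hcl hne x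
  have hxc : x ≠ c := fun h => hx (h ▸ hc)
  refine ⟨dist x c, dist_pos.2 hxc, {c}, Finset.singleton_nonempty c, fun z hz hzC => ?_⟩
  have hlt := hz c (Finset.mem_singleton_self c)
  rw [hP.eq_of_nearest_point hC hc hzC hmin] at hlt
  exact lt_irrefl _ hlt
end

section
/- Let (H, d) be a Hadamard space and K ⊆ H a bounded, metrically closed, convex set. Then K is weakly sequentially compact: every sequence in K has a subsequence converging weakly to a point of K. -/
open Filter Topology

variable {H : Type*} [MetricSpace H]

/-- Uniform convexity with the modulus of the squared distance: along geodesics, `F` satisfies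
the same inequality as `dist · z ^ 2`. -/
def GStronglyConvex (D : GeodesicStructure H) (F : H → ℝ) : Prop :=
  ∀ x y : H, ∀ t ∈ Set.Icc (0:ℝ) 1,
    F (D.G x y t) ≤ (1 - t) * F x + t * F y - t * (1 - t) * dist x y ^ 2

/-- A minimizer of a strongly convex function on a convex set satisfies quadratic growth. -/
lemma GStronglyConvex.add_sq_dist_le {D : GeodesicStructure H} {F : H → ℝ}
    (hF : GStronglyConvex D F) {K : Set H} (hcv : GConvex D K) {l : H} (hl : l ∈ K)
    (hmin : ∀ z ∈ K, F l ≤ F z) {z : H} (hz : z ∈ K) : F l + dist l z ^ 2 ≤ F z := by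
  have key : ∀ t ∈ Set.Ioo (0:ℝ) 1, F l + (1 - t) * dist l z ^ 2 ≤ F z := by
    intro t ht
    have ht' : t ∈ Set.Icc (0:ℝ) 1 := ⟨ht.1.le, ht.2.le⟩
    have h1 := (hmin _ (hcv l hl z hz t ht')).trans (hF l z t ht')
    have h2 : t * (F l + (1 - t) * dist l z ^ 2) ≤ t * F z := by linarith
    exact le_of_mul_le_mul_left h2 ht.1
  have hlim : Tendsto (fun t : ℝ => F l + (1 - t) * dist l z ^ 2) (𝓝[>] 0)
      (𝓝 (F l + (1 - 0) * dist l z ^ 2)) :=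
    (Continuous.tendsto (by fun_prop) 0).mono_left nhdsWithin_le_nhds
  have := le_of_tendsto hlim
    (by filter_upwards [Ioo_mem_nhdsGT (zero_lt_one' ℝ)] with t ht using key t ht)
  linarith

/-- A strongly convex, lower semicontinuous function that is bounded below attains its minimum
on every nonempty closed convex set. -/
lemma GStronglyConvex.exists_min [CompleteSpace H] {D : GeodesicStructure H} {F : H → ℝ}
    (hF : GStronglyConvex D F) (hlsc : LowerSemicontinuous F) (hbdd : BddBelow (Set.range F))
    {K : Set H} (hcl : IsClosed K) (hcv : GConvex D K) (hne : K.Nonempty) :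
    ∃ l ∈ K, ∀ z ∈ K, F l ≤ F z := by
  have hbK : BddBelow (F '' K) := hbdd.mono (Set.image_subset_range F K)
  set m := sInf (F '' K) with hm
  have hmle : ∀ z ∈ K, m ≤ F z := fun z hz => csInf_le hbK ⟨z, hz, rfl⟩
  have hex : ∀ k : ℕ, ∃ u ∈ K, F u < m + 1 / ((k:ℝ) + 1) := by
    intro k
    obtain ⟨_, ⟨u, hu, rfl⟩, h⟩ := exists_lt_of_csInf_lt (hne.image F)
      (lt_add_of_pos_right m (Nat.one_div_pos_of_nat (n := k) (α := ℝ)))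
    exact ⟨u, hu, h⟩
  choose u huK hu using hex
  have hcauchy : CauchySeq u := by
    refine cauchySeq_of_le_tendsto_0 (fun N : ℕ => √(4 * (1 / ((N:ℝ) + 1)))) ?_ ?_
    · intro n k N hn hk
      apply Real.le_sqrt_of_sq_le
      have h1 := hF (u n) (u k) (1 / 2) (by norm_num)
      have h2 := hmle _ (hcv _ (huK n) _ (huK k) (1 / 2) (by norm_num))
      have h3 := (hu n).trans_le (add_le_add_right (Nat.one_div_le_one_div (α := ℝ) hn) m)
      have h4 := (hu k).trans_le (add_le_add_right (Nat.one_div_le_one_div (α := ℝ) hk) m)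
      linarith
    · have h := ((tendsto_one_div_add_atTop_nhds_zero_nat (𝕜 := ℝ)).const_mul 4).sqrt
      simpa using h
  obtain ⟨l, hl⟩ := cauchySeq_tendsto_of_complete hcauchy
  have hlK : l ∈ K := hcl.mem_of_tendsto hl (.of_forall huK)
  refine ⟨l, hlK, fun z hz => le_trans ?_ (hmle z hz)⟩
  refine le_of_forall_lt fun c hc => ?_
  obtain ⟨c', hcc', hc'⟩ := exists_between hc
  have hlim : Tendsto (fun k : ℕ => m + 1 / ((k:ℝ) + 1)) atTop (𝓝 m) := by
    simpa using (tendsto_one_div_add_atTop_nhds_zero_nat (𝕜 := ℝ)).const_add m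
  refine hcc'.trans_le (ge_of_tendsto hlim ?_)
  filter_upwards [hl.eventually (hlsc l c' hc')] with k hk using (hk.trans (hu k)).le

lemma gStronglyConvex_sq_dist (D : GeodesicStructure H) (z : H) :
    GStronglyConvex D (fun y => dist y z ^ 2) :=
  fun x y t ht => D.cat0 x y z t ht

/-- Every point `p` has a projection `q` onto a nonempty closed convex set, satisfying the
Pythagorean inequality. -/
lemma exists_proj [CompleteSpace H] (D : GeodesicStructure H) {K : Set H} (hcl : IsClosed K)
    (hcv : GConvex D K) (hne : K.Nonempty) (p : H) :
    ∃ q ∈ K, ∀ z ∈ K, dist q p ^ 2 + dist q z ^ 2 ≤ dist z p ^ 2 := by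
  have hF := gStronglyConvex_sq_dist D p
  obtain ⟨q, hq, hmin⟩ := hF.exists_min
    (Continuous.lowerSemicontinuous (by fun_prop))
    ⟨0, by rintro _ ⟨y, rfl⟩; positivity⟩ hcl hcv hne
  exact ⟨q, hq, fun z hz => hF.add_sq_dist_le hcv hq hmin hz⟩

/-- The asymptotic squared distance from `z` to the sequence `x` along the filter `L`. -/
noncomputable def asympSqDist (x : ℕ → H) (L : Filter ℕ) (z : H) : ℝ :=
  limsup (fun n => dist z (x n) ^ 2) L

/-- The asymptotic squared radius of the sequence `x` along the filter `L`. -/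
noncomputable def asympSqRadius (x : ℕ → H) (L : Filter ℕ) : ℝ :=
  ⨅ z, asympSqDist x L z

section Asymptotic

variable {x : ℕ → H} {L L' : Filter ℕ}

lemma exists_forall_dist_le (hx : Bornology.IsBounded (Set.range x)) (z : H) :
    ∃ R, ∀ n, dist z (x n) ≤ R := by
  obtain ⟨R, hR⟩ := (Metric.isBounded_iff_subset_closedBall z).1 hx
  exact ⟨R, fun n => by simpa [dist_comm] using hR ⟨n, rfl⟩⟩

lemma isBoundedUnder_sq_dist (hx : Bornology.IsBounded (Set.range x)) (L : Filter ℕ) (z : H) :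
    IsBoundedUnder (· ≤ ·) L (fun n => dist z (x n) ^ 2) := by
  obtain ⟨R, hR⟩ := exists_forall_dist_le hx z
  exact isBoundedUnder_of ⟨R ^ 2, fun n => pow_le_pow_left₀ dist_nonneg (hR n) 2⟩

lemma isCoboundedUnder_sq_dist (x : ℕ → H) (L : Filter ℕ) [L.NeBot] (z : H) :
    IsCoboundedUnder (· ≤ ·) L (fun n => dist z (x n) ^ 2) :=
  (isBoundedUnder_of ⟨0, fun _ => sq_nonneg _⟩ :
    IsBoundedUnder (· ≥ ·) L (fun n => dist z (x n) ^ 2)).isCoboundedUnder_le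

lemma eventually_lt_of_asympSqDist_lt (hx : Bornology.IsBounded (Set.range x)) {z : H} {c : ℝ}
    (h : asympSqDist x L z < c) : ∀ᶠ n in L, dist z (x n) ^ 2 < c :=
  eventually_lt_of_limsup_lt h (isBoundedUnder_sq_dist hx L z)

lemma asympSqDist_le [L.NeBot] {z : H} {c : ℝ} (h : ∀ᶠ n in L, dist z (x n) ^ 2 ≤ c) :
    asympSqDist x L z ≤ c :=
  limsup_le_of_le (isCoboundedUnder_sq_dist x L z) h

lemma asympSqDist_nonneg [L.NeBot] (hx : Bornology.IsBounded (Set.range x)) (z : H) :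
    0 ≤ asympSqDist x L z := by
  by_contra! h
  obtain ⟨n, hn⟩ := (eventually_lt_of_asympSqDist_lt hx h).exists
  exact absurd (sq_nonneg _) hn.not_ge

lemma bddBelow_range_asympSqDist [L.NeBot] (hx : Bornology.IsBounded (Set.range x)) :
    BddBelow (Set.range (asympSqDist x L)) :=
  ⟨0, by rintro _ ⟨z, rfl⟩; exact asympSqDist_nonneg hx z⟩

lemma asympSqRadius_nonneg [L.NeBot] (hx : Bornology.IsBounded (Set.range x)) :
    0 ≤ asympSqRadius x L :=
  Real.iInf_nonneg fun z => asympSqDist_nonneg hx z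

lemma asympSqRadius_le_asympSqDist [L.NeBot] (hx : Bornology.IsBounded (Set.range x)) (z : H) :
    asympSqRadius x L ≤ asympSqDist x L z :=
  ciInf_le (bddBelow_range_asympSqDist hx) z

lemma asympSqDist_mono [L'.NeBot] (hx : Bornology.IsBounded (Set.range x)) (h : L' ≤ L) (z : H) :
    asympSqDist x L' z ≤ asympSqDist x L z :=
  limsup_le_limsup_of_le h (isCoboundedUnder_sq_dist x L' z) (isBoundedUnder_sq_dist hx L z)

lemma asympSqRadius_mono [L'.NeBot] (hx : Bornology.IsBounded (Set.range x)) (h : L' ≤ L) :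
    asympSqRadius x L' ≤ asympSqRadius x L :=
  ciInf_mono (bddBelow_range_asympSqDist hx) (asympSqDist_mono hx h)

lemma gStronglyConvex_asympSqDist [L.NeBot] (D : GeodesicStructure H)
    (hx : Bornology.IsBounded (Set.range x)) : GStronglyConvex D (asympSqDist x L) := by
  intro a b t ht
  refine le_of_forall_pos_le_add fun ε hε => asympSqDist_le ?_
  filter_upwards [eventually_lt_of_asympSqDist_lt hx (lt_add_of_pos_right (asympSqDist x L a) hε),
    eventually_lt_of_asympSqDist_lt hx (lt_add_of_pos_right (asympSqDist x L b) hε)] with n ha hb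
  have h1 := mul_le_mul_of_nonneg_left ha.le (sub_nonneg.2 ht.2)
  have h2 := mul_le_mul_of_nonneg_left hb.le ht.1
  linarith [D.cat0 a b (x n) t ht]

lemma lowerSemicontinuous_asympSqDist [L.NeBot] (hx : Bornology.IsBounded (Set.range x)) :
    LowerSemicontinuous (asympSqDist x L) := by
  intro w c hc
  obtain ⟨R, hR⟩ := exists_forall_dist_le hx w
  have key : ∀ z, asympSqDist x L w - dist w z * (2 * R + dist w z) ≤ asympSqDist x L z := by
    intro z
    refine le_of_forall_pos_le_add fun ε hε => ?_
    rw [sub_le_iff_le_add]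
    refine asympSqDist_le ?_
    filter_upwards [eventually_lt_of_asympSqDist_lt hx
      (lt_add_of_pos_right (asympSqDist x L z) hε)] with n hn
    have h1 := dist_triangle w z (x n)
    have h2 := dist_triangle_left z (x n) w
    have h3 := hR n
    have h4 := dist_nonneg (x := w) (y := z)
    have h5 := dist_nonneg (x := z) (y := x n)
    have h6 := dist_nonneg (x := w) (y := x n)
    nlinarith
  have hlim : Tendsto (fun z => asympSqDist x L w - dist w z * (2 * R + dist w z)) (𝓝 w)
      (𝓝 (asympSqDist x L w)) := by
    have : Continuous fun z => asympSqDist x L w - dist w z * (2 * R + dist w z) := by fun_prop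
    simpa using this.tendsto w
  filter_upwards [hlim.eventually (lt_mem_nhds hc)] with z hz using hz.trans_le (key z)

end Asymptotic

/-- A monotone nonnegative function on nontrivial countably generated filters becomes constant
on all filters below a suitable one. -/
lemma exists_filter_le_forall_le {α : Type*} (r : Filter α → ℝ)
    (h0 : ∀ L : Filter α, L.NeBot → 0 ≤ r L)
    (hmono : ∀ L L' : Filter α, L'.NeBot → L' ≤ L → r L' ≤ r L)
    (L₀ : Filter α) [hne₀ : L₀.NeBot] [hcg₀ : L₀.IsCountablyGenerated] :
    ∃ L ≤ L₀, L.NeBot ∧ L.IsCountablyGenerated ∧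
      ∀ L' ≤ L, L'.NeBot → L'.IsCountablyGenerated → r L ≤ r L' := by
  let S := {L : Filter α // L.NeBot ∧ L.IsCountablyGenerated}
  have step : ∀ (k : ℕ) (L : S), ∃ M : S, M.1 ≤ L.1 ∧
      ∀ N : S, N.1 ≤ L.1 → r M.1 ≤ r N.1 + 1 / ((k:ℝ) + 1) := by
    intro k L
    let A := {c | ∃ N : S, N.1 ≤ L.1 ∧ r N.1 = c}
    have hA : BddBelow A := ⟨0, by rintro _ ⟨N, -, rfl⟩; exact h0 _ N.2.1⟩
    obtain ⟨_, ⟨M, hM, rfl⟩, hlt⟩ := exists_lt_of_csInf_lt (s := A) ⟨_, L, le_rfl, rfl⟩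
      (lt_add_of_pos_right (sInf A) (Nat.one_div_pos_of_nat (n := k) (α := ℝ)))
    exact ⟨M, hM, fun N hN => hlt.le.trans (by gcongr; exact csInf_le hA ⟨N, hN, rfl⟩)⟩
  choose next hle hnext using step
  let M : ℕ → S := fun k => Nat.rec ⟨L₀, hne₀, hcg₀⟩ next k
  have hanti : Antitone fun k => (M k).1 := antitone_nat_of_succ_le fun k => hle k (M k)
  have hne : ∀ k, (M k).1.NeBot := fun k => (M k).2.1
  have hcg : ∀ k, (M k).1.IsCountablyGenerated := fun k => (M k).2.2
  have hL : (⨅ k, (M k).1).NeBot := iInf_neBot_of_directed' hanti.directed_ge hne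
  refine ⟨⨅ k, (M k).1, iInf_le (fun k => (M k).1) 0, hL, inferInstance, ?_⟩
  intro L' hL' hne' hcg'
  have hbound : ∀ k : ℕ, r (⨅ k, (M k).1) ≤ r L' + 1 / ((k:ℝ) + 1) := fun k =>
    (hmono _ _ hL (iInf_le (fun k => (M k).1) (k + 1))).trans
      (hnext k (M k) ⟨L', hne', hcg'⟩ (hL'.trans (iInf_le (fun k => (M k).1) k)))
  have hlim : Tendsto (fun k : ℕ => r L' + 1 / ((k:ℝ) + 1)) atTop (𝓝 (r L')) := by
    simpa using (tendsto_one_div_add_atTop_nhds_zero_nat (𝕜 := ℝ)).const_add (r L')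
  exact ge_of_tendsto' hlim hbound

lemma isCompact_seg (D : GeodesicStructure H) (a b : H) : IsCompact (seg D a b) := by
  refine isCompact_Icc.image_of_continuousOn (LipschitzOnWith.continuousOn
    (K := ⟨dist a b, dist_nonneg⟩) (LipschitzOnWith.of_dist_le_mul fun s hs t ht => ?_))
  rw [D.G_dist a b s hs t ht, mul_comm, Real.dist_eq]
  rfl

/-- a bounded closed convex subset of a Hadamard space is weakly
sequentially compact. -/
theorem stmt6 [CompleteSpace H] (D : GeodesicStructure H) (P : H → H → H → H)
    (hP : IsProjMap D P) (K : Set H) (hb : Bornology.IsBounded K)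
    (hcl : IsClosed K) (hcv : GConvex D K) :
    ∀ x : ℕ → H, (∀ n, x n ∈ K) →
      ∃ l ∈ K, ∃ φ : ℕ → ℕ, StrictMono φ ∧ WeakConv P (x ∘ φ) l := by
  intro x hxK
  have hx : Bornology.IsBounded (Set.range x) := hb.subset (Set.range_subset_iff.2 hxK)
  obtain ⟨L, hLtop, hLne, hLcg, hLmin⟩ := exists_filter_le_forall_le (asympSqRadius x)
    (fun L _ => asympSqRadius_nonneg hx) (fun L L' _ h => asympSqRadius_mono hx h) atTop
  have huniv : GConvex D Set.univ := fun _ _ _ _ _ _ => trivial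
  obtain ⟨l, -, hl⟩ := (gStronglyConvex_asympSqDist (L := L) D hx).exists_min
    (lowerSemicontinuous_asympSqDist hx) (bddBelow_range_asympSqDist hx) isClosed_univ huniv
    ⟨x 0, trivial⟩
  -- `l` is the unique asymptotic center along every countably generated filter below `L`
  have hcenter : ∀ L' ≤ L, L'.NeBot → L'.IsCountablyGenerated → ∀ z,
      asympSqDist x L' z ≤ asympSqDist x L' l → l = z := by
    intro L' hL' hne' hcg' z hz
    have : Nonempty H := ⟨l⟩
    have hmin : ∀ w ∈ Set.univ, asympSqDist x L' l ≤ asympSqDist x L' w := fun w _ =>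
      calc asympSqDist x L' l ≤ asympSqDist x L l := asympSqDist_mono hx hL' l
        _ ≤ asympSqRadius x L := le_ciInf fun v => hl v trivial
        _ ≤ asympSqRadius x L' := hLmin L' hL' hne' hcg'
        _ ≤ asympSqDist x L' w := asympSqRadius_le_asympSqDist hx w
    have h := (gStronglyConvex_asympSqDist (L := L') D hx).add_sq_dist_le huniv trivial hmin
      (Set.mem_univ z)
    have h0 : dist l z ^ 2 = 0 := le_antisymm (by linarith) (sq_nonneg _)
    exact dist_eq_zero.1 (pow_eq_zero_iff two_ne_zero |>.1 h0)
  have hlK : l ∈ K := by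
    obtain ⟨q, hq, hproj⟩ := exists_proj D hcl hcv ⟨x 0, hxK 0⟩ l
    rw [hcenter L le_rfl hLne hLcg q ?_]
    · exact hq
    refine limsup_le_limsup (.of_forall fun n => ?_) (isCoboundedUnder_sq_dist x L q)
      (isBoundedUnder_sq_dist hx L l)
    have := hproj (x n) (hxK n)
    rw [dist_comm (x n) l] at this
    linarith [sq_nonneg (dist q l)]
  obtain ⟨θ, hθ⟩ := L.exists_seq_tendsto
  obtain ⟨η, hη, hφ⟩ := strictMono_subseq_of_tendsto_atTop (hθ.mono_right hLtop)
  have hφL : Tendsto (θ ∘ η) atTop L := hθ.comp hη.tendsto_atTop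
  refine ⟨l, hlK, θ ∘ η, hφ, fun y => ?_⟩
  refine tendsto_of_subseq_tendsto fun ns hns => ?_
  obtain ⟨p, -, ψ, hψ, hp⟩ := (isCompact_seg D l y).tendsto_subseq
    (fun n => (hP l y ((x ∘ θ ∘ η) (ns n))).1)
  refine ⟨ψ, ?_⟩
  let ω : ℕ → ℕ := fun n => θ (η (ns (ψ n)))
  have hω : map ω atTop ≤ L := hφL.comp (hns.comp hψ.tendsto_atTop)
  have hlp : l = p := by
    refine hcenter (map ω atTop) hω inferInstance inferInstance p ?_
    obtain ⟨R, hR⟩ := exists_forall_dist_le hx l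
    refine le_of_forall_pos_le_add fun ε hε => asympSqDist_le ?_
    have hlim : Tendsto (fun n => 2 * R * dist p (P l y (x (ω n))) +
        dist p (P l y (x (ω n))) ^ 2) atTop (𝓝 0) := by
      have h : Tendsto (fun n => dist p (P l y (x (ω n)))) atTop (𝓝 0) :=
        dist_self p ▸ (tendsto_const_nhds (x := p)).dist hp
      simpa using (h.const_mul (2 * R)).add (h.pow 2)
    have hlt := eventually_lt_of_asympSqDist_lt (L := map ω atTop) hx
      (lt_add_of_pos_right (asympSqDist x (map ω atTop) l) (half_pos hε))
    rw [eventually_map] at hlt ⊢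
    filter_upwards [hlt, hlim.eventually (gt_mem_nhds (half_pos hε))] with n h1 h2
    have h3 : dist (P l y (x (ω n))) (x (ω n)) ≤ dist l (x (ω n)) := by
      have := (hP l y (x (ω n))).2 l ⟨0, by simp, D.G_zero l y⟩
      rwa [dist_comm _ (x (ω n)), dist_comm l]
    have h4 := dist_triangle p (P l y (x (ω n))) (x (ω n))
    have h5 := hR (ω n)
    have h6 : dist p (x (ω n)) ^ 2 ≤
        (dist p (P l y (x (ω n))) + dist l (x (ω n))) ^ 2 :=
      pow_le_pow_left₀ dist_nonneg (by linarith) 2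
    have h7 := mul_le_mul_of_nonneg_left h5 (dist_nonneg (x := p) (y := P l y (x (ω n))))
    nlinarith
  subst hlp
  exact dist_self l ▸ (tendsto_const_nhds (x := l)).dist hp
end

section
/- Let (H, d) be a Hadamard space that is locally compact in its metric topology. If a sequence (x_n) in H converges weakly to some x ∈ H, then the set {x_n : n ∈ ℕ} is bounded. -/
open Filter Topology

variable {H : Type*} [MetricSpace H]

/-- If the point of `[l, z]` at distance `r` from `l` is within `δ` of `y`, then the projection of
`z` onto `[l, y]` is at distance at least `r - δ` from `l`. -/
lemma le_dist_proj (D : GeodesicStructure H) {P : H → H → H → H} (hP : IsProjMap D P)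
    {l y z : H} {r δ : ℝ} (hr : 0 ≤ r) (hz : 0 < dist l z) (hrz : r ≤ dist l z)
    (hy : dist (D.G l z (r / dist l z)) y ≤ δ) : r - δ ≤ dist l (P l y z) := by
  have ht : r / dist l z ∈ Set.Icc (0 : ℝ) 1 :=
    ⟨div_nonneg hr hz.le, div_le_one_of_le₀ hrz hz.le⟩
  have hend : dist (D.G l z (r / dist l z)) z = dist l z - r := by
    have h := D.G_dist l z _ ht 1 (Set.right_mem_Icc.2 zero_le_one)
    rw [D.G_one, abs_of_nonpos (by linarith [ht.2])] at h
    rw [h]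
    field_simp
    ring
  have hproj : dist z (P l y z) ≤ dist z y :=
    (hP l y z).2 y ⟨1, Set.right_mem_Icc.2 zero_le_one, D.G_one l y⟩
  have h₁ := dist_triangle l (P l y z) z
  have h₂ := dist_triangle z (D.G l z (r / dist l z)) y
  rw [dist_comm (P l y z) z] at h₁
  rw [dist_comm z (D.G l z _)] at h₂
  linarith

/-- A weakly convergent sequence is eventually inside every compact
closed ball around its limit. -/
lemma WeakConv.eventually_dist_lt (D : GeodesicStructure H) {P : H → H → H → H}
    (hP : IsProjMap D P) {x : ℕ → H} {l : H} (hw : WeakConv P x l) {r : ℝ} (hr : 0 < r)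
    (hc : IsCompact (Metric.closedBall l r)) : ∀ᶠ n in atTop, dist l (x n) < r := by
  obtain ⟨Y, -, hY, hcover⟩ := hc.finite_cover_balls (half_pos hr)
  have hev : ∀ᶠ n in atTop, ∀ y ∈ Y, dist l (P l y (x n)) < r / 2 :=
    (eventually_all_finite hY).2 fun y _ => (hw y).eventually_lt_const (half_pos hr)
  filter_upwards [hev] with n hn
  by_contra! hrn
  have hpos : 0 < dist l (x n) := hr.trans_le hrn
  have hmem : D.G l (x n) (r / dist l (x n)) ∈ Metric.closedBall l r := by
    have h := D.G_dist l (x n) (r / dist l (x n))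
      ⟨by positivity, div_le_one_of_le₀ hrn hpos.le⟩ 0 (Set.left_mem_Icc.2 zero_le_one)
    rw [D.G_zero, sub_zero, abs_of_nonneg (by positivity), div_mul_cancel₀ _ hpos.ne'] at h
    exact h.le
  obtain ⟨y, hy, hball⟩ := Set.mem_iUnion₂.1 (hcover hmem)
  have := le_dist_proj D hP hr.le hpos hrn (Metric.mem_ball.1 hball).le
  linarith [hn y hy]

/-- in a locally compact Hadamard space every weakly convergent
sequence is bounded. -/
theorem stmt9 [CompleteSpace H] [LocallyCompactSpace H] (D : GeodesicStructure H)
    (P : H → H → H → H) (hP : IsProjMap D P) (x : ℕ → H) (l : H)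
    (hw : WeakConv P x l) :
    Bornology.IsBounded (Set.range x) := by
  obtain ⟨r, hr, hc⟩ := Metric.exists_isCompact_closedBall l
  obtain ⟨N, hN⟩ := eventually_atTop.1 (hw.eventually_dist_lt D hP hr hc)
  refine (((Set.finite_Iio N).image x).isBounded.union
    (Metric.isBounded_ball (x := l) (r := r))).subset ?_
  rintro _ ⟨n, rfl⟩
  rcases lt_or_ge n N with h | h
  · exact Or.inl ⟨n, h, rfl⟩
  · exact Or.inr (Metric.mem_ball'.2 (hN n h))
end

section
/- Let (H, d) be a Hadamard space that is locally compact in its metric topology. Then the weak topology and the metric topology coincide: a set U ⊆ H is weakly open if and only if it is open in the metric topology. -/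
open Filter Topology

variable {H : Type*} [MetricSpace H]

/-- Projecting `z` onto `[x,y]` moves it at most as far as the left endpoint `x`. -/
lemma IsProjMap.dist_left_le {D : GeodesicStructure H} {P : H → H → H → H}
    (hP : IsProjMap D P) (x y z : H) : dist z (P x y z) ≤ dist z x :=
  (hP x y z).2 x ⟨0, by simp, D.G_zero x y⟩

/-- Projecting `z` onto `[x,y]` moves it at most as far as the right endpoint `y`. -/
lemma IsProjMap.dist_right_le {D : GeodesicStructure H} {P : H → H → H → H}
    (hP : IsProjMap D P) (x y z : H) : dist z (P x y z) ≤ dist z y :=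
  (hP x y z).2 y ⟨1, by simp, D.G_one x y⟩

/-- A point at distance at least `r` from `x` is joined to `x` through the sphere of radius `r`. -/
lemma GeodesicStructure.exists_dist_eq (D : GeodesicStructure H) {x z : H} {r : ℝ}
    (hr : 0 < r) (hz : r ≤ dist x z) :
    ∃ w, dist x w = r ∧ dist w z = dist x z - r := by
  have hd : 0 < dist x z := hr.trans_le hz
  have h0 : 0 ≤ r / dist x z := by positivity
  have h1 : r / dist x z ≤ 1 := (div_le_one hd).2 hz
  refine ⟨D.G x z (r / dist x z), ?_, ?_⟩
  · have h := D.G_dist x z 0 (by simp) (r / dist x z) ⟨h0, h1⟩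
    rw [D.G_zero, zero_sub, abs_neg, abs_of_nonneg h0] at h
    rw [h]
    field_simp
  · have h := D.G_dist x z (r / dist x z) ⟨h0, h1⟩ 1 (by simp)
    rw [D.G_one, abs_of_nonpos (by linarith)] at h
    rw [h]
    field_simp
    ring

lemma IsOpen.weaklyOpen [LocallyCompactSpace H] {D : GeodesicStructure H}
    {P : H → H → H → H} (hP : IsProjMap D P) {U : Set H} (hU : IsOpen U) :
    WeaklyOpen P U := by
  classical
  intro x hx
  obtain ⟨K, hK, hKU, hKc⟩ := local_compact_nhds (hU.mem_nhds hx)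
  obtain ⟨r, hr, hrK⟩ := Metric.nhds_basis_closedBall.mem_iff.1 hK
  obtain ⟨t, -, htf, ht⟩ := hKc.finite_cover_balls (half_pos hr)
  refine ⟨r / 2, half_pos hr, insert x htf.toFinset, by simp, fun z hz => ?_⟩
  by_contra hzU
  have hrz : r ≤ dist x z := by
    by_contra! h
    exact hzU (hKU (hrK (by rw [Metric.mem_closedBall, dist_comm]; exact h.le)))
  obtain ⟨w, hxw, hwz⟩ := D.exists_dist_eq hr hrz
  have hw : w ∈ K := hrK (by rw [Metric.mem_closedBall, dist_comm, hxw])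
  obtain ⟨y, hyt, hwy⟩ := Set.mem_iUnion₂.1 (ht hw)
  rw [Metric.mem_ball] at hwy
  have h1 : dist x (P x y z) < r / 2 := hz y (by simp [hyt])
  have h2 := hP.dist_right_le x y z
  have h3 := dist_triangle_left z y w
  have h4 := dist_triangle_right x z (P x y z)
  linarith

/-- in a locally compact Hadamard space the weak topology and
the metric topology coincide. -/
theorem stmt10 [CompleteSpace H] [LocallyCompactSpace H] (D : GeodesicStructure H)
    (P : H → H → H → H) (hP : IsProjMap D P) (U : Set H) :
    WeaklyOpen P U ↔ IsOpen U :=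
  ⟨WeaklyOpen.isOpen hP, IsOpen.weaklyOpen hP⟩
end

section
/- Let (H, d) be a Hadamard space and g : H → ℝ a geodesically convex function that is lower semicontinuous with respect to the metric topology. Then g is bounded from below on every bounded subset of H, and for every x₀ ∈ H and every r > 0 there exists p ∈ H with d(x₀, p) ≤ r such that g(p) ≤ g(q) for every q ∈ H with d(x₀, q) ≤ r. (This is the content of Theorem 5.6 of the paper, transported from the space Γ_x(H) of geodesic segments to H along the isometry γ ↦ γ(1).) -/
open Filter Topology

variable {H : Type*} [MetricSpace H]

/-- Closed balls of a Hadamard space are geodesically convex. -/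
lemma gConvex_closedBall (D : GeodesicStructure H) (x₀ : H) (r : ℝ) :
    GConvex D (Metric.closedBall x₀ r) := by
  intro a ha b hb t ht
  rw [Metric.mem_closedBall] at *
  have hr : 0 ≤ r := dist_nonneg.trans ha
  have ha2 : dist a x₀ ^ 2 ≤ r ^ 2 := by gcongr
  have hb2 : dist b x₀ ^ 2 ≤ r ^ 2 := by gcongr
  have hcat := D.cat0 a b x₀ t ht
  have hat := mul_le_mul_of_nonneg_left ha2 (sub_nonneg.2 ht.2)
  have hbt := mul_le_mul_of_nonneg_left hb2 ht.1
  have hab : 0 ≤ t * (1 - t) * dist a b ^ 2 :=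
    mul_nonneg (mul_nonneg ht.1 (sub_nonneg.2 ht.2)) (sq_nonneg _)
  exact (sq_le_sq₀ dist_nonneg hr).1 (by linarith)

/-- A decreasing sequence of nonempty closed convex subsets of a ball in a Hadamard space has
nonempty intersection. -/
lemma nonempty_iInter_of_gConvex [CompleteSpace H] (D : GeodesicStructure H) {C : ℕ → Set H}
    (hanti : Antitone C) (hclosed : ∀ n, IsClosed (C n)) (hconv : ∀ n, GConvex D (C n))
    (hne : ∀ n, (C n).Nonempty) {x₀ : H} {r : ℝ} (hball : ∀ n, C n ⊆ Metric.closedBall x₀ r) :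
    (⋂ n, C n).Nonempty := by
  let δ : ℕ → ℝ := fun n => Metric.infDist x₀ (C n)
  have hδ_mono : Monotone δ := fun m n hmn =>
    Metric.infDist_le_infDist_of_subset (hanti hmn) (hne n)
  have hδ_bdd : BddAbove (Set.range δ) := by
    refine ⟨r, ?_⟩
    rintro _ ⟨n, rfl⟩
    obtain ⟨y, hy⟩ := hne n
    exact (Metric.infDist_le_dist_of_mem hy).trans (Metric.mem_closedBall'.1 (hball n hy))
  let d : ℝ := ⨆ n, δ n
  have hδ_le : ∀ n, δ n ≤ d := le_ciSup hδ_bdd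
  have hδ_lim : Tendsto δ atTop (𝓝 d) := tendsto_atTop_ciSup hδ_mono hδ_bdd
  have hnear : ∀ n : ℕ, ∃ y ∈ C n, dist x₀ y < δ n + 1 / ((n : ℝ) + 1) := fun n =>
    (Metric.infDist_lt_iff (hne n)).1 (lt_add_of_pos_right _ Nat.one_div_pos_of_nat)
  choose x hxC hxd using hnear
  have hx_le : ∀ N n, N ≤ n → dist (x n) x₀ ≤ d + 1 / ((N : ℝ) + 1) := by
    intro N n hN
    rw [dist_comm]
    exact (hxd n).le.trans (add_le_add (hδ_le n) (Nat.one_div_le_one_div hN))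
  have hcauchy : CauchySeq x := by
    refine cauchySeq_of_le_tendsto_0
      (fun N : ℕ => √(4 * ((d + 1 / ((N : ℝ) + 1)) ^ 2 - δ N ^ 2))) ?_ ?_
    · intro n m N hn hm
      refine Real.le_sqrt_of_sq_le ?_
      have hmid : D.G (x n) (x m) (1 / 2) ∈ C N :=
        hconv N _ (hanti hn (hxC n)) _ (hanti hm (hxC m)) _ (by norm_num)
      have hlow : δ N ^ 2 ≤ dist (D.G (x n) (x m) (1 / 2)) x₀ ^ 2 := by
        refine pow_le_pow_left₀ Metric.infDist_nonneg ?_ 2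
        rw [dist_comm]
        exact Metric.infDist_le_dist_of_mem hmid
      have hcat := D.cat0 (x n) (x m) x₀ (1 / 2) (by norm_num)
      have hn2 := pow_le_pow_left₀ dist_nonneg (hx_le N n hn) 2
      have hm2 := pow_le_pow_left₀ dist_nonneg (hx_le N m hm) 2
      linarith
    · have hlim := (((tendsto_const_nhds (x := d)).add
        tendsto_one_div_add_atTop_nhds_zero_nat).pow 2).sub (hδ_lim.pow 2)
      simpa using (hlim.const_mul 4).sqrt
  obtain ⟨p, hp⟩ := cauchySeq_tendsto_of_complete hcauchy
  refine ⟨p, Set.mem_iInter.2 fun n => (hclosed n).mem_of_tendsto hp ?_⟩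
  filter_upwards [eventually_ge_atTop n] with m hm using hanti hm (hxC m)

/-- If the sublevel sets of a convex lower semicontinuous function at decreasing levels all meet a
closed ball, then they have a common point in that ball. -/
lemma exists_mem_closedBall_forall_le [CompleteSpace H] (D : GeodesicStructure H) {g : H → ℝ}
    (hconv : ∀ a b : H, ∀ t ∈ Set.Icc (0:ℝ) 1, g (D.G a b t) ≤ (1 - t) * g a + t * g b)
    (hlsc : LowerSemicontinuous g) {x₀ : H} {r : ℝ} {u : ℕ → ℝ} (hu : Antitone u)
    (hne : ∀ n, ∃ z ∈ Metric.closedBall x₀ r, g z ≤ u n) :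
    ∃ p ∈ Metric.closedBall x₀ r, ∀ n, g p ≤ u n := by
  obtain ⟨p, hp⟩ := nonempty_iInter_of_gConvex D
    (C := fun n => Metric.closedBall x₀ r ∩ {z | g z ≤ u n}) (x₀ := x₀) (r := r)
    (fun m n hmn z hz => ⟨hz.1, hz.2.trans (hu hmn)⟩)
    (fun n => Metric.isClosed_closedBall.inter (hlsc.isClosed_preimage (u n)))
    (fun n a ha b hb t ht => ⟨gConvex_closedBall D x₀ r a ha.1 b hb.1 t ht, by
      have hat := mul_le_mul_of_nonneg_left (show g a ≤ u n from ha.2) (sub_nonneg.2 ht.2)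
      have hbt := mul_le_mul_of_nonneg_left (show g b ≤ u n from hb.2) ht.1
      exact (hconv a b t ht).trans (by linarith)⟩)
    hne (fun n => Set.inter_subset_left)
  rw [Set.mem_iInter] at hp
  exact ⟨p, (hp 0).1, fun n => (hp n).2⟩

lemma bddBelow_image_closedBall [CompleteSpace H] (D : GeodesicStructure H) {g : H → ℝ}
    (hconv : ∀ a b : H, ∀ t ∈ Set.Icc (0:ℝ) 1, g (D.G a b t) ≤ (1 - t) * g a + t * g b)
    (hlsc : LowerSemicontinuous g) (x₀ : H) (r : ℝ) :
    BddBelow (g '' Metric.closedBall x₀ r) := by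
  by_contra hunb
  rw [not_bddBelow_iff] at hunb
  obtain ⟨p, -, hp⟩ := exists_mem_closedBall_forall_le D hconv hlsc (x₀ := x₀) (r := r)
    (u := fun n : ℕ => -(n : ℝ)) (fun m n hmn => neg_le_neg (Nat.cast_le.2 hmn)) (fun n => by
      obtain ⟨_, ⟨z, hz, rfl⟩, hlt⟩ := hunb (-(n : ℝ))
      exact ⟨z, hz, hlt.le⟩)
  obtain ⟨n, hn⟩ := exists_nat_gt (-g p)
  linarith [hp n]

/-- a geodesically convex lower semicontinuous real function on
a Hadamard space is bounded below on bounded sets and attains its minimum on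
every closed ball. -/
theorem stmt11 [CompleteSpace H] (D : GeodesicStructure H) (g : H → ℝ)
    (hconv : ∀ a b : H, ∀ t ∈ Set.Icc (0:ℝ) 1,
      g (D.G a b t) ≤ (1 - t) * g a + t * g b)
    (hlsc : LowerSemicontinuous g) :
    (∀ B : Set H, Bornology.IsBounded B → ∃ m : ℝ, ∀ z ∈ B, m ≤ g z) ∧
    (∀ x₀ : H, ∀ r : ℝ, 0 < r → ∃ p : H, dist x₀ p ≤ r ∧
      ∀ q : H, dist x₀ q ≤ r → g p ≤ g q) := by
  refine ⟨fun B hB => ?_, fun x₀ r hr => ?_⟩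
  · obtain rfl | ⟨x₀, -⟩ := B.eq_empty_or_nonempty
    · exact ⟨0, by simp⟩
    · obtain ⟨r, hr⟩ := hB.subset_closedBall x₀
      obtain ⟨m, hm⟩ := bddBelow_image_closedBall D hconv hlsc x₀ r
      exact ⟨m, fun z hz => hm (Set.mem_image_of_mem g (hr hz))⟩
  · have hbdd := bddBelow_image_closedBall D hconv hlsc x₀ r
    have hne : (g '' Metric.closedBall x₀ r).Nonempty :=
      (Metric.nonempty_closedBall.2 hr.le).image g
    obtain ⟨u, hu, hlim, hmem⟩ := exists_seq_tendsto_sInf hne hbdd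
    obtain ⟨p, hp, hle⟩ := exists_mem_closedBall_forall_le D hconv hlsc (x₀ := x₀) (r := r) hu
      (fun n => by
        obtain ⟨z, hz, hzu⟩ := hmem n
        exact ⟨z, hz, hzu.le⟩)
    refine ⟨p, Metric.mem_closedBall'.1 hp, fun q hq => ?_⟩
    exact (ge_of_tendsto' hlim hle).trans
      (csInf_le hbdd (Set.mem_image_of_mem g (Metric.mem_closedBall'.2 hq)))
end

section
/- Let ℋ be a real Hilbert space. Then every elementary set is weakly open; that is, for all x, a ∈ ℋ, every ε > 0, and every y ∈ ℋ with ‖x − P_{[x,a]} y‖ < ε, there exist δ > 0 and finitely many points b_1, …, b_k ∈ ℋ such that {z ∈ ℋ : ‖y − P_{[y,b_i]} z‖ < δ for all i = 1, …, k} ⊆ {z ∈ ℋ : ‖x − P_{[x,a]} z‖ < ε}. In particular, ℋ is weakly proper. -/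
open Filter Topology

variable {E : Type*} [NormedAddCommGroup E] [InnerProductSpace ℝ E]

/-- `P` is the metric-projection map onto segments: `P x a z` is the nearest
point to `z` on the segment `[x,a]`. -/
def IsSegProj (P : E → E → E → E) : Prop :=
  ∀ x a z : E, P x a z ∈ segment ℝ x a ∧
    ∀ q ∈ segment ℝ x a, ‖z - P x a z‖ ≤ ‖z - q‖

/-- The variational inequality characterising the projection onto a segment. -/
lemma IsSegProj.inner_le_zero {P : E → E → E → E} (hP : IsSegProj P) (x a z : E) {q : E}
    (hq : q ∈ segment ℝ x a) : inner ℝ (z - P x a z) (q - P x a z) ≤ 0 := by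
  obtain ⟨hmem, hmin⟩ := hP x a z
  have : Nonempty (segment ℝ x a) := ⟨⟨_, hmem⟩⟩
  refine (norm_eq_iInf_iff_real_inner_le_zero (convex_segment x a) hmem).1 ?_ q hq
  refine le_antisymm (le_ciInf fun w => hmin w w.2) ?_
  exact ciInf_le (f := fun w : segment ℝ x a => ‖z - w‖)
    ⟨0, by rintro _ ⟨w, rfl⟩; exact norm_nonneg _⟩ ⟨_, hmem⟩

/-- An elementary set whose radius does not exceed the length of the segment is an open
half-space. -/
lemma IsSegProj.norm_sub_lt_iff {P : E → E → E → E} (hP : IsSegProj P) {x a : E} (z : E) {r : ℝ}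
    (hr : 0 < r) (hra : r ≤ ‖a - x‖) :
    ‖x - P x a z‖ < r ↔ inner ℝ (z - x) (a - x) < r * ‖a - x‖ := by
  have hleft := hP.inner_le_zero x a z (left_mem_segment ℝ x a)
  have hright := hP.inner_le_zero x a z (right_mem_segment ℝ x a)
  have hmem := (hP x a z).1
  rw [segment_eq_image'] at hmem
  obtain ⟨t, ⟨ht0, -⟩, ht⟩ := hmem
  dsimp only at ht
  rw [← ht] at hleft hright ⊢
  have hnorm : ‖x - (x + t • (a - x))‖ = t * ‖a - x‖ := by
    rw [sub_add_cancel_left, norm_neg, norm_smul, Real.norm_of_nonneg ht0]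
  have hz : z - (x + t • (a - x)) = (z - x) - t • (a - x) := by abel
  have hx : x - (x + t • (a - x)) = (-t) • (a - x) := by module
  have ha : a - (x + t • (a - x)) = (1 - t) • (a - x) := by module
  rw [hz, hx, inner_smul_right, inner_sub_left, real_inner_smul_left,
    real_inner_self_eq_norm_sq] at hleft
  rw [hz, ha, inner_smul_right, inner_sub_left, real_inner_smul_left,
    real_inner_self_eq_norm_sq] at hright
  rw [hnorm]
  have hv : 0 < ‖a - x‖ := hr.trans_le hra
  constructor
  · intro h
    have ht1 : t < 1 := by nlinarith
    have := nonpos_of_mul_nonpos_right hright (sub_pos.2 ht1)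
    nlinarith
  · intro h
    rcases ht0.eq_or_lt with rfl | htpos
    · simpa using hr
    · have : t * ‖a - x‖ ^ 2 ≤ inner ℝ (z - x) (a - x) := by nlinarith
      refine lt_of_mul_lt_mul_right ?_ hv.le
      nlinarith

/-- in a real Hilbert space every elementary set is weakly open:
any point `y` of `U_x(ε; a)` admits `δ > 0` and finitely many `b_1, …, b_k`
with `U_y(δ; b_1, …, b_k) ⊆ U_x(ε; a)`. In particular a Hilbert space is
weakly proper. -/
theorem stmt16 [CompleteSpace E] (P : E → E → E → E) (hP : IsSegProj P)
    (x a : E) (ε : ℝ) (hε : 0 < ε) (y : E) (hy : ‖x - P x a y‖ < ε) :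
    ∃ δ > (0:ℝ), ∃ B : Finset E, B.Nonempty ∧
      {z : E | ∀ b ∈ B, ‖y - P y b z‖ < δ} ⊆ {z : E | ‖x - P x a z‖ < ε} := by
  rcases lt_or_ge ‖a - x‖ ε with h | h
  · refine ⟨1, one_pos, {y}, Finset.singleton_nonempty y, fun z _ => ?_⟩
    refine lt_of_le_of_lt ?_ h
    rw [norm_sub_rev]
    exact norm_sub_le_of_mem_segment (hP x a z).1
  · have hv : 0 < ‖a - x‖ := hε.trans_le h
    rw [hP.norm_sub_lt_iff y hε h] at hy
    set δ := min ‖a - x‖ (ε - inner ℝ (y - x) (a - x) / ‖a - x‖)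
    have hδ : 0 < δ := lt_min hv (sub_pos.2 ((div_lt_iff₀ hv).2 hy))
    refine ⟨δ, hδ, {y + (a - x)}, Finset.singleton_nonempty _, fun z hz => ?_⟩
    have hz' := hz _ (Finset.mem_singleton_self _)
    rw [hP.norm_sub_lt_iff z hδ (by simp [δ]), add_sub_cancel_left] at hz'
    refine (hP.norm_sub_lt_iff z hε h).2 ?_
    have hle : δ * ‖a - x‖ ≤ ε * ‖a - x‖ - inner ℝ (y - x) (a - x) := by
      calc δ * ‖a - x‖ ≤ (ε - inner ℝ (y - x) (a - x) / ‖a - x‖) * ‖a - x‖ := by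
            gcongr; exact min_le_right _ _
        _ = _ := by field_simp
    rw [← sub_add_sub_cancel z y x, inner_add_left]
    linarith
end

section
/- Let (H, d) be a Hadamard space. For x, z, y, w ∈ H define the quasi-inner product ⟨→xz, →yw⟩ := (1/2) · (d(x,y)² + d(z,w)² − d(x,w)² − d(z,y)²), and let τ_K (Kakavandi's topology) be the topology on H generated by the subbasis consisting of the sets W(x, y; ε) := {z ∈ H : |⟨→xz, →xy⟩| < ε} for x, y ∈ H and ε > 0. Then every weakly open set belongs to τ_K; that is, the weak topology τ_w is coarser than τ_K. -/
open Filter Topology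

variable {H : Type*} [MetricSpace H]

/-- The quasi-inner product `⟨→xz, →yw⟩` of Berg--Nikolaev. -/
noncomputable def qip (x z y w : H) : ℝ :=
  (dist x y ^ 2 + dist z w ^ 2 - dist x w ^ 2 - dist z y ^ 2) / 2

/-- Kakavandi's topology, generated by the subbasic sets
`W(x,y;ε) = {z | |⟨→xz,→xy⟩| < ε}`. -/
def tauK (H : Type*) [MetricSpace H] : TopologicalSpace H :=
  TopologicalSpace.generateFrom
    {S : Set H | ∃ (x y : H) (ε : ℝ), 0 < ε ∧ S = {z : H | |qip x z x y| < ε}}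

/-- A sub-geodesic of a geodesic is the geodesic joining its endpoints. -/
theorem GeodesicStructure.G_G (D : GeodesicStructure H) (x y : H) {r t : ℝ}
    (hr : r ∈ Set.Icc (0 : ℝ) 1) (ht : t ∈ Set.Icc (0 : ℝ) 1) :
    D.G x (D.G x y t) r = D.G x y (r * t) := by
  have hrt : r * t ∈ Set.Icc (0 : ℝ) 1 :=
    ⟨mul_nonneg hr.1 ht.1, mul_le_one₀ hr.2 ht.1 ht.2⟩
  have h0 : (0 : ℝ) ∈ Set.Icc (0 : ℝ) 1 := by simp
  have hcat := D.cat0 x (D.G x y t) (D.G x y (r * t)) r hr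
  have h1 := D.G_dist x y 0 h0 (r * t) hrt
  have h2 := D.G_dist x y 0 h0 t ht
  have h3 := D.G_dist x y t ht (r * t) hrt
  rw [D.G_zero] at h1 h2
  rw [h1, h2, h3] at hcat
  simp only [mul_pow, sq_abs] at hcat
  have hle : dist (D.G x (D.G x y t) r) (D.G x y (r * t)) ^ 2 ≤ 0 := by
    linarith
  exact dist_eq_zero.mp (pow_eq_zero_iff two_ne_zero |>.mp (le_antisymm hle (sq_nonneg _)))

/-- If the projection of `z` to `[x, y]` is at distance at least `ε` from `x`, then the point `w`
of `[x, y]` at distance `ε` from `x` satisfies `|⟨→xz, →xw⟩| ≥ ε² / 2`. -/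
theorem sq_div_two_le_abs_qip (D : GeodesicStructure H) {P : H → H → H → H}
    (hP : IsProjMap D P) {x y z : H} {ε : ℝ} (hε : 0 < ε) (h : ε ≤ dist x (P x y z)) :
    ε ^ 2 / 2 ≤ |qip x z x (D.G x y (ε / dist x y))| := by
  obtain ⟨⟨t, ht, hp⟩, hmin⟩ := hP x y z
  have h0 : (0 : ℝ) ∈ Set.Icc (0 : ℝ) 1 := by simp
  have hxz := hmin x ⟨0, h0, D.G_zero x y⟩
  set p := P x y z
  dsimp only at hp
  have hxp : dist x p = t * dist x y := by
    have := D.G_dist x y 0 h0 t ht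
    rwa [D.G_zero, hp, zero_sub, abs_neg, abs_of_nonneg ht.1] at this
  have ha : 0 < dist x p := hε.trans_le h
  have hxy : dist x y ≠ 0 := fun h' => by simp [hxp, h'] at ha
  have ht0 : t ≠ 0 := fun h' => by simp [hxp, h'] at ha
  have hr : ε / dist x p ∈ Set.Icc (0 : ℝ) 1 := ⟨by positivity, (div_le_one ha).mpr h⟩
  have hw : D.G x p (ε / dist x p) = D.G x y (ε / dist x y) := by
    have := D.G_G x y hr ht
    rw [hp] at this
    rw [this]
    congr 1
    rw [hxp]
    field_simp
  rw [← hw]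
  have hra : ε / dist x p * dist x p = ε := div_mul_cancel₀ _ ha.ne'
  generalize ε / dist x p = r at *
  have hxw : dist x (D.G x p r) = ε := by
    have := D.G_dist x p 0 h0 r hr
    rwa [D.G_zero, zero_sub, abs_neg, abs_of_nonneg hr.1, hra] at this
  have hcat := D.cat0 x p z r hr
  have hsq : r * dist p z ^ 2 ≤ r * dist x z ^ 2 := by
    rw [dist_comm p z, dist_comm x z]
    have := hr.1
    gcongr
  have hrsq : r * (1 - r) * dist x p ^ 2 = ε * dist x p - ε ^ 2 := by
    rw [← hra]; ring
  have hεa : ε ^ 2 ≤ ε * dist x p := by rw [sq]; gcongr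
  refine le_trans ?_ (neg_le_abs _)
  rw [qip, dist_self, hxw, dist_comm z x, dist_comm z]
  linarith

/-- every weakly open set is open in Kakavandi's topology, i.e.
`τ_w ⊆ τ_K`. -/
theorem stmt17 [CompleteSpace H] (D : GeodesicStructure H) (P : H → H → H → H)
    (hP : IsProjMap D P) (U : Set H) (hU : WeaklyOpen P U) :
    IsOpen[tauK H] U := by
  refine (@isOpen_iff_forall_mem_open H (tauK H) U).mpr fun x hx => ?_
  obtain ⟨ε, hε, Y, -, hYU⟩ := hU x hx
  refine ⟨⋂ y ∈ Y, {z : H | |qip x z x (D.G x y (ε / dist x y))| < ε ^ 2 / 2}, ?_, ?_, ?_⟩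
  · intro z hz
    refine hYU fun y hy => ?_
    by_contra! h
    exact (Set.mem_iInter₂.mp hz y hy).not_ge (sq_div_two_le_abs_qip D hP hε h)
  · exact @isOpen_biInter_finset H H (tauK H) Y _ fun y _ =>
      TopologicalSpace.isOpen_generateFrom_of_mem ⟨x, _, _, by positivity, rfl⟩
  · refine Set.mem_iInter₂.mpr fun y _ => ?_
    simp only [Set.mem_ofPred_eq, qip, dist_self]
    norm_num
    positivity
end

section
/- Let (H, d) be a Hadamard space and let τ_M be the coarsest topology on H in which every metrically closed convex subset of H is closed. Assume that for every geodesic segment γ = [a, b] the metric projection P_γ is geodesically monotone, i.e. for all x₀, x₁ ∈ H the function α ↦ d(P_γ x₀, P_γ (G x₀ x₁ α)) is monotone (non-decreasing) on [0,1]. Then (H, τ_M) is a Hausdorff topological space. -/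
open Filter Topology

variable {H : Type*} [MetricSpace H]

/-- Monod's co-convex topology: the coarsest topology in which every metrically
closed convex set is closed. -/
def tauM (D : GeodesicStructure H) : TopologicalSpace H :=
  TopologicalSpace.generateFrom
    {U : Set H | ∃ C : Set H, IsClosed C ∧ GConvex D C ∧ U = Cᶜ}

namespace GeodesicStructure

/-- A point at the proportional distances from `x` and `y` is the geodesic point. -/
lemma G_eq_of_dist (D : GeodesicStructure H) {x y m : H} {t : ℝ} (ht : t ∈ Set.Icc (0 : ℝ) 1)
    (hx : dist x m = t * dist x y) (hy : dist y m = (1 - t) * dist x y) : D.G x y t = m := by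
  have h := D.cat0 x y m t ht
  have hle : dist (D.G x y t) m ^ 2 ≤ 0 := by
    refine h.trans (le_of_eq ?_)
    rw [hx, hy]
    ring
  exact dist_eq_zero.1 (pow_eq_zero_iff two_ne_zero |>.1 (le_antisymm hle (sq_nonneg _)))

lemma G_symm (D : GeodesicStructure H) (x y : H) {t : ℝ} (ht : t ∈ Set.Icc (0 : ℝ) 1) :
    D.G y x (1 - t) = D.G x y t := by
  have h0 : (0 : ℝ) ∈ Set.Icc (0 : ℝ) 1 := by simp
  have h1 : (1 : ℝ) ∈ Set.Icc (0 : ℝ) 1 := by simp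
  have hx := D.G_dist x y 0 h0 t ht
  have hy := D.G_dist x y 1 h1 t ht
  rw [D.G_zero, zero_sub, abs_neg, abs_of_nonneg ht.1] at hx
  rw [D.G_one, abs_of_nonneg (by linarith [ht.2])] at hy
  apply D.G_eq_of_dist ⟨by linarith [ht.2], by linarith [ht.1]⟩
  · rw [hy, dist_comm y x]
  · rw [hx, dist_comm y x]
    ring

/-- The midpoint of two points of a segment lies in the segment. -/
lemma G_half_mem_seg (D : GeodesicStructure H) {x y p q : H} (hp : p ∈ seg D x y)
    (hq : q ∈ seg D x y) : D.G p q (1 / 2) ∈ seg D x y := by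
  obtain ⟨s, hs, rfl⟩ := hp
  obtain ⟨t, ht, rfl⟩ := hq
  have hm : (s + t) / 2 ∈ Set.Icc (0 : ℝ) 1 :=
    ⟨by linarith [hs.1, ht.1], by linarith [hs.2, ht.2]⟩
  refine ⟨(s + t) / 2, hm, (D.G_eq_of_dist ⟨by norm_num, by norm_num⟩ ?_ ?_).symm⟩
  · rw [D.G_dist x y s hs _ hm, D.G_dist x y s hs t ht,
      show s - (s + t) / 2 = (1 / 2) * (s - t) by ring, abs_mul,
      abs_of_pos (by norm_num : (0 : ℝ) < 1 / 2)]
    ring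
  · rw [D.G_dist x y t ht _ hm, D.G_dist x y s hs t ht,
      show t - (s + t) / 2 = -((1 / 2) * (s - t)) by ring, abs_neg, abs_mul,
      abs_of_pos (by norm_num : (0 : ℝ) < 1 / 2)]
    ring

/-- Distances along a segment are differences of the distances to its first endpoint. -/
lemma dist_eq_abs_sub_of_mem_seg (D : GeodesicStructure H) {x y p q : H} (hp : p ∈ seg D x y)
    (hq : q ∈ seg D x y) : dist p q = |dist x p - dist x q| := by
  obtain ⟨s, hs, rfl⟩ := hp
  obtain ⟨t, ht, rfl⟩ := hq
  have h0 : (0 : ℝ) ∈ Set.Icc (0 : ℝ) 1 := by simp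
  have key : ∀ r ∈ Set.Icc (0 : ℝ) 1, dist x (D.G x y r) = r * dist x y := by
    intro r hr
    have h := D.G_dist x y 0 h0 r hr
    rwa [D.G_zero, zero_sub, abs_neg, abs_of_nonneg hr.1] at h
  rw [key s hs, key t ht, D.G_dist x y s hs t ht, ← sub_mul, abs_mul,
    abs_of_nonneg (dist_nonneg (x := x) (y := y))]

lemma left_mem_seg (D : GeodesicStructure H) (x y : H) : x ∈ seg D x y :=
  ⟨0, by simp, D.G_zero x y⟩

lemma right_mem_seg (D : GeodesicStructure H) (x y : H) : y ∈ seg D x y :=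
  ⟨1, by simp, D.G_one x y⟩

end GeodesicStructure

namespace IsProjMap

variable {D : GeodesicStructure H} {P : H → H → H → H}

lemma eq_self (hP : IsProjMap D P) {x y z : H} (hz : z ∈ seg D x y) : P x y z = z := by
  have h := (hP x y z).2 z hz
  rw [dist_self] at h
  exact (dist_le_zero.1 h).symm

lemma dist_sq_le_s19 (hP : IsProjMap D P) (x y z : H) {q : H} (hq : q ∈ seg D x y) :
    dist (P x y z) q ^ 2 ≤ 2 * (dist z q ^ 2 - dist z (P x y z) ^ 2) := by
  have hm := (hP x y z).2 _ (D.G_half_mem_seg (hP x y z).1 hq)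
  have hc := D.cat0 (P x y z) q z (1 / 2) ⟨by norm_num, by norm_num⟩
  rw [dist_comm _ z, dist_comm _ z, dist_comm q z] at hc
  have hsq := pow_le_pow_left₀ dist_nonneg hm 2
  linarith

lemma dist_proj_sq_le (hP : IsProjMap D P) (x y z w : H) :
    dist (P x y w) (P x y z) ^ 2 ≤ 8 * dist w z * (dist z x + dist w z) := by
  have h := hP.dist_sq_le_s19 x y z (hP x y w).1
  have h1 := (hP x y w).2 _ (hP x y z).1
  have h2 := dist_triangle z w (P x y w)
  have h3 := dist_triangle w z (P x y z)
  have h4 := (hP x y z).2 x (D.left_mem_seg x y)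
  rw [dist_comm z w] at h2
  rw [dist_comm (P x y z)] at h
  have h5 : dist z (P x y w) ≤ dist z (P x y z) + 2 * dist w z := by linarith
  have h6 := pow_le_pow_left₀ dist_nonneg h5 2
  have h7 := mul_le_mul_of_nonneg_left h4 (dist_nonneg (x := w) (y := z))
  nlinarith

lemma continuous_s19 (hP : IsProjMap D P) (x y : H) : Continuous (P x y) := by
  rw [continuous_iff_continuousAt]
  intro z
  rw [ContinuousAt, tendsto_iff_dist_tendsto_zero]
  have hb : Tendsto (fun w => √(8 * dist w z * (dist z x + dist w z))) (𝓝 z) (𝓝 0) := by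
    have hc : Continuous fun w => √(8 * dist w z * (dist z x + dist w z)) := by fun_prop
    simpa using hc.tendsto z
  exact squeeze_zero (fun _ => dist_nonneg)
    (fun w => Real.le_sqrt_of_sq_le (hP.dist_proj_sq_le x y z w)) hb

/-- If projections are geodesically monotone, the position of the projection of a point of `[u, v]`
lies between the positions of the projections of `u` and `v`. -/
lemma dist_proj_mem_uIcc (hP : IsProjMap D P)
    (hmono : ∀ a b x₀ x₁ : H,
      MonotoneOn (fun α : ℝ => dist (P a b x₀) (P a b (D.G x₀ x₁ α))) (Set.Icc (0 : ℝ) 1))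
    (x y u v : H) {t : ℝ} (ht : t ∈ Set.Icc (0 : ℝ) 1) :
    dist x (P x y (D.G u v t)) ∈ Set.uIcc (dist x (P x y u)) (dist x (P x y v)) := by
  have h1 : (1 : ℝ) ∈ Set.Icc (0 : ℝ) 1 := by simp
  have ht' : 1 - t ∈ Set.Icc (0 : ℝ) 1 := ⟨by linarith [ht.2], by linarith [ht.1]⟩
  have hu := hmono x y u v ht h1 ht.2
  have hv := hmono x y v u ht' h1 ht'.2
  simp only [D.G_one, D.G_symm u v ht] at hu hv
  rw [D.dist_eq_abs_sub_of_mem_seg (hP x y _).1 (hP x y _).1,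
    D.dist_eq_abs_sub_of_mem_seg (hP x y _).1 (hP x y _).1] at hu hv
  rw [Set.mem_uIcc]
  grind

/-- If projections are geodesically monotone, preimages of order-connected sets under the position
of the projection are convex. -/
lemma gConvex_preimage (hP : IsProjMap D P)
    (hmono : ∀ a b x₀ x₁ : H,
      MonotoneOn (fun α : ℝ => dist (P a b x₀) (P a b (D.G x₀ x₁ α))) (Set.Icc (0 : ℝ) 1))
    (x y : H) {s : Set ℝ} (hs : s.OrdConnected) :
    GConvex D ((fun z => dist x (P x y z)) ⁻¹' s) :=
  fun u hu v hv _ ht => hs.uIcc_subset hu hv (hP.dist_proj_mem_uIcc hmono x y u v ht)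

/-- If projections are geodesically monotone, complements of preimages of closed
order-connected sets under the position of the projection are open in `τ_M`. -/
lemma isOpen_tauM_compl_preimage (hP : IsProjMap D P)
    (hmono : ∀ a b x₀ x₁ : H,
      MonotoneOn (fun α : ℝ => dist (P a b x₀) (P a b (D.G x₀ x₁ α))) (Set.Icc (0 : ℝ) 1))
    (x y : H) {s : Set ℝ} (hs : s.OrdConnected) (hc : IsClosed s) :
    IsOpen[tauM D] ((fun z => dist x (P x y z)) ⁻¹' s)ᶜ :=
  TopologicalSpace.isOpen_generateFrom_of_mem
    ⟨_, hc.preimage (continuous_const.dist (hP.continuous_s19 x y)),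
      hP.gConvex_preimage hmono x y hs, rfl⟩

end IsProjMap

/-- if all metric projections onto geodesic segments are
geodesically monotone, then Monod's topology `τ_M` is Hausdorff. -/
theorem stmt19 [CompleteSpace H] (D : GeodesicStructure H) (P : H → H → H → H)
    (hP : IsProjMap D P)
    (hmono : ∀ a b x₀ x₁ : H,
      MonotoneOn (fun α : ℝ => dist (P a b x₀) (P a b (D.G x₀ x₁ α)))
        (Set.Icc (0:ℝ) 1)) :
    @T2Space H (tauM D) := by
  refine @T2Space.mk H (tauM D) fun x y hxy => ?_
  refine ⟨_, _, hP.isOpen_tauM_compl_preimage hmono x y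
      (Set.ordConnected_Ici (a := dist x y / 2)) isClosed_Ici,
    hP.isOpen_tauM_compl_preimage hmono x y
      (Set.ordConnected_Iic (a := dist x y / 2)) isClosed_Iic, ?_, ?_, ?_⟩
  · simp [hP.eq_self (D.left_mem_seg x y), hxy]
  · simp [hP.eq_self (D.right_mem_seg x y), hxy]
  · rw [Set.disjoint_left]
    intro z hz hz'
    simp only [Set.mem_compl_iff, Set.mem_preimage, Set.mem_Ici, Set.mem_Iic, not_le] at hz hz'
    exact lt_asymm hz hz'
end
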